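/- arXiv:1706.05070 — 2 statements merged into one kernel-verified Lean document; each statement's English description precedes it below -/
import Mathlib

section
/- Let G and G' be representatives. Then G' is an immediate descendant of G if and only if G' ≠ G, S(G') ⊊ S(G), and for every f ∈ S(G) \ S(G'), the pointwise disjunction G' ∨ f equals G pointwise. Moreover, if G' ≠ G, S(G') ⊊ S(G), and for some f ∈ S(G) \ S(G') one has G' ∨ f ≠ G, then the representative ⋁{g ∈ ℱ | g ⇒ G' ∨ f} is a descendant of G and an ascendant of G' (i.e., it strictly implies G and is strictly implied by G'). -/
namespace Spex

variable {X : Type*}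

/-- `F₁ ⇒ F₂`: `F₁` logically implies `F₂`. -/
def Imp (F₁ F₂ : X → Bool) : Prop := ∀ x, F₁ x = true → F₂ x = true

/-- The pointwise disjunction `⋁S` of a set of boolean functions, as a predicate on `X`. -/
def DisjOn (S : Set (X → Bool)) (x : X) : Prop := ∃ f ∈ S, f x = true

/-- `S(P) = {f ∈ ℱ | f ⇒ P}` for a `Prop`-valued target `P`. -/
def SOfP (ℱ : Set (X → Bool)) (P : X → Prop) : Set (X → Bool) :=
  {f | f ∈ ℱ ∧ ∀ x, f x = true → P x}

/-- `S(G) = {f ∈ ℱ | f ⇒ G}`. -/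
def SOf (ℱ : Set (X → Bool)) (G : X → Bool) : Set (X → Bool) :=
  SOfP ℱ (fun x => G x = true)

/-- `G` is a representative: `G = ⋁{f ∈ ℱ | f ⇒ G}` pointwise. -/
def IsRep (ℱ : Set (X → Bool)) (G : X → Bool) : Prop :=
  ∀ x, G x = true ↔ DisjOn (SOf ℱ G) x

/-- A `Prop`-valued function is a representative: `P = ⋁{f ∈ ℱ | f ⇒ P}` pointwise. -/
def IsRepP (ℱ : Set (X → Bool)) (P : X → Prop) : Prop :=
  ∀ x, P x ↔ DisjOn (SOfP ℱ P) x

/-- `G₁` is a descendant of `G₂`. -/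
def Desc (ℱ : Set (X → Bool)) (G₁ G₂ : X → Bool) : Prop :=
  IsRep ℱ G₁ ∧ IsRep ℱ G₂ ∧ Imp G₁ G₂ ∧ G₁ ≠ G₂

/-- `G₁` is an immediate descendant of `G₂`. -/
def ImmDesc (ℱ : Set (X → Bool)) (G₁ G₂ : X → Bool) : Prop :=
  Desc ℱ G₁ G₂ ∧
    ¬ ∃ G : X → Bool, IsRep ℱ G ∧ Imp G₁ G ∧ Imp G G₂ ∧ G ≠ G₁ ∧ G ≠ G₂

/-- `Z(G,X') = {f ∈ S(G) | f(X') = 0}`. -/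
def ZSet (ℱ : Set (X → Bool)) (G : X → Bool) (X' : Set X) : Set (X → Bool) :=
  {f | f ∈ SOf ℱ G ∧ ∀ x ∈ X', f x = false}

theorem Imp.antisymm {F₁ F₂ : X → Bool} (h : Imp F₁ F₂) (h' : Imp F₂ F₁) : F₁ = F₂ :=
  funext fun x => Bool.eq_iff_iff.mpr ⟨h x, h' x⟩

theorem IsRep.imp_of_sOf_subset {ℱ : Set (X → Bool)} {G₁ G₂ : X → Bool}
    (h₁ : IsRep ℱ G₁) (h : SOf ℱ G₁ ⊆ SOf ℱ G₂) : Imp G₁ G₂ := by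
  intro x hx
  obtain ⟨f, hf, hfx⟩ := (h₁ x).1 hx
  exact (h hf).2 x hfx

theorem Imp.sOf_subset {ℱ : Set (X → Bool)} {G₁ G₂ : X → Bool}
    (h : Imp G₁ G₂) : SOf ℱ G₁ ⊆ SOf ℱ G₂ :=
  fun _ hf => ⟨hf.1, fun x hx => h x (hf.2 x hx)⟩

/-- Adjoining a member of `ℱ` to a representative gives a representative. -/
theorem IsRep.isRepP_or {ℱ : Set (X → Bool)} {G f : X → Bool}
    (hG : IsRep ℱ G) (hf : f ∈ ℱ) : IsRepP ℱ (fun x => G x = true ∨ f x = true) := by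
  intro x
  constructor
  · rintro (hx | hx)
    · obtain ⟨g, hg, hgx⟩ := (hG x).1 hx
      exact ⟨g, ⟨hg.1, fun y hy => Or.inl (hg.2 y hy)⟩, hgx⟩
    · exact ⟨f, ⟨hf, fun _ hy => Or.inr hy⟩, hx⟩
  · rintro ⟨g, hg, hgx⟩
    exact hg.2 x hgx

theorem IsRep.isRep_or {ℱ : Set (X → Bool)} {G f : X → Bool}
    (hG : IsRep ℱ G) (hf : f ∈ ℱ) : IsRep ℱ (fun x => G x || f x) := by
  simpa only [IsRep, IsRepP, SOf, Bool.or_eq_true] using hG.isRepP_or hf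

theorem stmt11 (ℱ : Set (X → Bool)) (hfin : ℱ.Finite) (G G' : X → Bool)
    (hG : IsRep ℱ G) (hG' : IsRep ℱ G') :
    (ImmDesc ℱ G' G ↔
      (G' ≠ G ∧ SOf ℱ G' ⊂ SOf ℱ G ∧
        ∀ f ∈ SOf ℱ G \ SOf ℱ G', ∀ x, (G' x = true ∨ f x = true) ↔ G x = true)) ∧
    (∀ f ∈ SOf ℱ G \ SOf ℱ G',
      G' ≠ G → SOf ℱ G' ⊂ SOf ℱ G →
      ¬ (∀ x, (G' x = true ∨ f x = true) ↔ G x = true) →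
      ((∀ x, DisjOn (SOfP ℱ (fun y => G' y = true ∨ f y = true)) x → G x = true) ∧
       ¬ (∀ x, DisjOn (SOfP ℱ (fun y => G' y = true ∨ f y = true)) x ↔ G x = true) ∧
       (∀ x, G' x = true → DisjOn (SOfP ℱ (fun y => G' y = true ∨ f y = true)) x) ∧
       ¬ (∀ x, DisjOn (SOfP ℱ (fun y => G' y = true ∨ f y = true)) x ↔ G' x = true))) := by
  refine ⟨⟨?_, ?_⟩, ?_⟩
  · rintro ⟨⟨-, -, himp, hne⟩, hmid⟩
    refine ⟨hne, ⟨himp.sOf_subset, fun h => hne (himp.antisymm (hG.imp_of_sOf_subset h))⟩, ?_⟩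
    rintro f ⟨hfG, hfG'⟩ x
    have heq : (fun x => G' x || f x) = G := by
      by_contra hneG
      refine hmid ⟨_, hG'.isRep_or hfG.1, fun y hy => by simp [hy], fun y hy => ?_, ?_, hneG⟩
      · exact (Bool.or_eq_true _ _ ▸ hy).elim (himp y) (hfG.2 y)
      · intro h
        exact hfG' ⟨hfG.1, fun y hy => (congrFun h y).symm.trans (by simp [hy])⟩
    rw [← congrFun heq x, Bool.or_eq_true]
  · rintro ⟨hne, hss, hall⟩
    refine ⟨⟨hG', hG, hG'.imp_of_sOf_subset hss.1, hne⟩, ?_⟩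
    rintro ⟨G₀, hG₀, hG'G₀, hG₀G, hneG', hneG⟩
    obtain ⟨f, hfG₀, hfG'⟩ := Set.not_subset.mp fun h =>
      hneG' ((hG₀.imp_of_sOf_subset h).antisymm hG'G₀)
    refine hneG (hG₀G.antisymm fun x hx => ?_)
    exact ((hall f ⟨hG₀G.sOf_subset hfG₀, hfG'⟩ x).2 hx).elim (hG'G₀ x) (hfG₀.2 x)
  · rintro f ⟨hfG, hfG'⟩ - hss hnot
    have key : ∀ x, DisjOn (SOfP ℱ (fun y => G' y = true ∨ f y = true)) x ↔
        (G' x = true ∨ f x = true) := fun x => (hG'.isRepP_or hfG.1 x).symm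
    simp only [key]
    exact ⟨fun x hx => hx.elim (hG'.imp_of_sOf_subset hss.1 x) (hfG.2 x), hnot,
      fun _ => Or.inl, fun h => hfG' ⟨hfG.1, fun y hy => (h y).1 (Or.inr hy)⟩⟩

end Spex
end

section
/- Let G be a representative and let G₁, …, G_m be pairwise distinct immediate descendants of G. If A ⊆ X is a set of points such that for every i ∈ {1,…,m} there exists a ∈ A with G_i a ≠ G a, then A has at least m elements. (Consequently, any adaptive membership-query algorithm learning ℱ_∨ must, in the worst case, ask at least max over representatives G of the number of immediate descendants of G queries.) -/
namespace Spex

variable {X : Type*}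

/-- The pointwise disjunction of two representatives is a representative. -/
theorem IsRep.or {ℱ : Set (X → Bool)} {G H : X → Bool} (hG : IsRep ℱ G) (hH : IsRep ℱ H) :
    IsRep ℱ (fun x => G x || H x) := by
  intro x
  constructor
  · intro h
    rcases Bool.or_eq_true _ _ |>.mp h with h | h
    · obtain ⟨f, ⟨hf, hfG⟩, hx⟩ := (hG x).mp h
      exact ⟨f, ⟨hf, fun y hy => by simp [hfG y hy]⟩, hx⟩
    · obtain ⟨f, ⟨hf, hfH⟩, hx⟩ := (hH x).mp h
      exact ⟨f, ⟨hf, fun y hy => by simp [hfH y hy]⟩, hx⟩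
  · rintro ⟨f, ⟨-, hf⟩, hx⟩
    exact hf x hx

/-- Distinct immediate descendants of `G` have disjunction `G`. -/
theorem ImmDesc.or_eq {ℱ : Set (X → Bool)} {G G₁ G₂ : X → Bool} (h₁ : ImmDesc ℱ G₁ G)
    (h₂ : ImmDesc ℱ G₂ G) (hne : G₁ ≠ G₂) : (fun x => G₁ x || G₂ x) = G := by
  obtain ⟨⟨hr₁, -, hi₁, -⟩, hn₁⟩ := h₁
  obtain ⟨⟨hr₂, -, hi₂, -⟩, hn₂⟩ := h₂
  by_contra hG
  have hle : Imp (fun x => G₁ x || G₂ x) G := fun x hx =>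
    (Bool.or_eq_true _ _ |>.mp hx).elim (hi₁ x) (hi₂ x)
  have e₁ : (fun x => G₁ x || G₂ x) = G₁ := by
    by_contra h
    exact hn₁ ⟨_, hr₁.or hr₂, fun x hx => by simp [hx], hle, h, hG⟩
  have e₂ : (fun x => G₁ x || G₂ x) = G₂ := by
    by_contra h
    exact hn₂ ⟨_, hr₁.or hr₂, fun x hx => by simp [hx], hle, h, hG⟩
  exact hne (e₁.symm.trans e₂)

theorem stmt14 (ℱ : Set (X → Bool)) (hfin : ℱ.Finite) (G : X → Bool)
    (hG : IsRep ℱ G)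
    (m : ℕ) (Gs : Fin m → X → Bool) (hinj : Function.Injective Gs)
    (himm : ∀ i, ImmDesc ℱ (Gs i) G)
    (A : Finset X) (hA : ∀ i : Fin m, ∃ a ∈ A, Gs i a ≠ G a) :
    m ≤ A.card := by
  choose a haA ha using hA
  have ha_inj : Function.Injective a := by
    intro i j hij
    by_contra hne
    have hor := congrFun ((himm i).or_eq (himm j) (hinj.ne hne)) (a i)
    have hi := ha i
    have hj := ha j
    rw [← hij] at hj
    revert hor hi hj
    cases Gs i (a i) <;> cases Gs j (a i) <;> cases G (a i) <;> simp
  simpa using Finset.card_le_card_of_injOn (s := Finset.univ) a (fun i _ => haA i) ha_inj.injOn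

end Spex
end
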